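/- Let k ≥ 2 and n ≥ 1 be integers, and let w : Φ_{2,k} → Σ_{k+1} be the bijection sending σ ∈ Φ_{2,k} to its number of 1 entries. If C ⊆ Σ_{k+1}^n is a code that corrects a single limited-magnitude error of magnitude 1 without wrap-around, then C′ = { c ∈ Φ_{2,k}^n : (w(c[1]),…,w(c[n])) ∈ C } is a binary k-resolution 1-CECC. -/

import Mathlib

/-- A binary sequence in `Φ_{2,k}^n`, viewed as a `k × n` matrix over `{0,1}`,
is valid if every column is nondecreasing. -/
def ValidSeq2 (k n : ℕ) (s : Fin k → Fin n → Fin 2) : Prop :=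
  ∀ j : Fin n, Monotone fun i : Fin k => s i j

/-- `y` is obtained from `c` by at most one limited-magnitude error of magnitude `1`
without wrap-around. -/
def LME1 {n Q : ℕ} (c y : Fin n → Fin Q) : Prop :=
  ∃ i : Fin n, (∀ j : Fin n, j ≠ i → y j = c j) ∧
    ((y i).val = (c i).val ∨ (y i).val = (c i).val + 1 ∨ (y i).val + 1 = (c i).val)

/-- The bijection `w : Φ_{2,k} → Σ_{k+1}` applied to column `j` of `c`: the number
of `1` entries of that column. -/
def wcol (k n : ℕ) (c : Fin k → Fin n → Fin 2) (j : Fin n) : Fin (k + 1) :=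
  ⟨(Finset.univ.filter fun i : Fin k => c i j = 1).card, by
    have h : (Finset.univ.filter fun i : Fin k => c i j = 1).card ≤ k := by
      simpa using Finset.card_filter_le (Finset.univ : Finset (Fin k))
        (fun i : Fin k => c i j = 1)
    omega⟩

theorem exists_pos (k n : ℕ) (hk : 2 ≤ k) (hn : 1 ≤ n) (c y : Fin k → Fin n → Fin 2)
    (h : (∑ i : Fin k, hammingDist (y i) (c i)) ≤ 1) :
    ∃ i0 j0, ∀ i j, (i ≠ i0 ∨ j ≠ j0) → y i j = c i j := by
  have h1 : (Finset.univ.sigma (fun i : Fin k =>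
      Finset.univ.filter (fun j : Fin n => y i j ≠ c i j))).card ≤ 1 := by
    rw [Finset.card_sigma]; exact h
  rw [Finset.card_le_one] at h1
  by_cases he : ∃ i0 j0, y i0 j0 ≠ c i0 j0
  · obtain ⟨i0, j0, h0⟩ := he
    refine ⟨i0, j0, fun i j hij => ?_⟩
    by_contra hne
    have := h1 ⟨i, j⟩ (by simp [hne]) ⟨i0, j0⟩ (by simp [h0])
    simp only [Sigma.mk.injEq, heq_eq_eq] at this
    tauto
  · push Not at he
    exact ⟨⟨0, by omega⟩, ⟨0, by omega⟩, fun i j _ => he i j⟩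

theorem card_step (k n : ℕ) (c y : Fin k → Fin n → Fin 2) (i0 : Fin k) (j : Fin n)
    (h : ∀ i, i ≠ i0 → y i j = c i j) : (wcol k n y j).val ≤ (wcol k n c j).val + 1 := by
  simp only [wcol]
  refine le_trans (Finset.card_le_card ?_) (Finset.card_insert_le i0 _)
  intro i hi
  simp only [Finset.mem_insert, Finset.mem_filter, Finset.mem_univ, true_and] at hi ⊢
  by_cases h0 : i = i0
  · exact Or.inl h0
  · right; rw [← h i h0]; exact hi

theorem lme_of (k n : ℕ) (hk : 2 ≤ k) (hn : 1 ≤ n) (c y : Fin k → Fin n → Fin 2)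
    (h : (∑ i : Fin k, hammingDist (y i) (c i)) ≤ 1) :
    LME1 (fun j => wcol k n c j) (fun j => wcol k n y j) := by
  obtain ⟨i0, j0, h⟩ := exists_pos k n hk hn c y h
  refine ⟨j0, fun j hj => ?_, ?_⟩
  · have : ∀ i, y i j = c i j := fun i => h i j (Or.inr hj)
    simp [wcol, this]
  · have h1 := card_step k n c y i0 j0 (fun i hi => h i j0 (Or.inl hi))
    have h2 := card_step k n y c i0 j0 (fun i hi => (h i j0 (Or.inl hi)).symm)
    dsimp only
    omega

theorem wcol_inj (k n : ℕ) (c c' : Fin k → Fin n → Fin 2) (hc : ValidSeq2 k n c)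
    (hc' : ValidSeq2 k n c') (h : (fun j => wcol k n c j) = fun j => wcol k n c' j) :
    c = c' := by
  funext i j
  have hcard := congrArg Fin.val (congrFun h j)
  simp only [wcol] at hcard
  have up : ∀ d : Fin k → Fin n → Fin 2, ValidSeq2 k n d → IsUpperSet {i | d i j = 1} := by
    intro d hd a b hab ha
    have h1 : d a j ≤ d b j := hd j hab
    simp only [Set.mem_ofPred_eq] at ha ⊢
    omega
  have key : (Finset.univ.filter fun i : Fin k => c i j = 1)
      = Finset.univ.filter fun i : Fin k => c' i j = 1 := by
    rcases (up c hc).total (up c' hc') with hs | hs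
    · exact Finset.eq_of_subset_of_card_le (fun a ha => by
        simp only [Finset.mem_filter, Finset.mem_univ, true_and] at ha ⊢
        exact hs ha) hcard.ge
    · exact (Finset.eq_of_subset_of_card_le (fun a ha => by
        simp only [Finset.mem_filter, Finset.mem_univ, true_and] at ha ⊢
        exact hs ha) hcard.le).symm
  have := Finset.ext_iff.1 key i
  simp only [Finset.mem_filter, Finset.mem_univ, true_and] at this
  omega

/-- Lemma `lem_reduce1`: if `C ⊆ Σ_{k+1}^n` corrects a single `1`-LME without
wrap-around, then `C' = {c ∈ Φ_{2,k}^n : (w(c[1]),…,w(c[n])) ∈ C}` is a binary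
`k`-resolution `1`-CECC. -/
theorem stmt18 (k n : ℕ) (hk : 2 ≤ k) (hn : 1 ≤ n)
    (C : Set (Fin n → Fin (k + 1)))
    (hC : ∀ x ∈ C, ∀ x' ∈ C, x ≠ x' →
      ¬∃ y : Fin n → Fin (k + 1), LME1 x y ∧ LME1 x' y) :
    ∀ c ∈ {c : Fin k → Fin n → Fin 2 | ValidSeq2 k n c ∧ (fun j => wcol k n c j) ∈ C},
    ∀ c' ∈ {c : Fin k → Fin n → Fin 2 | ValidSeq2 k n c ∧ (fun j => wcol k n c j) ∈ C},
      c ≠ c' →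
        ¬∃ y : Fin k → Fin n → Fin 2,
          (∑ i : Fin k, hammingDist (y i) (c i)) ≤ 1 ∧
          (∑ i : Fin k, hammingDist (y i) (c' i)) ≤ 1 := by
  rintro c ⟨hv, hm⟩ c' ⟨hv', hm'⟩ hne ⟨y, h1, h2⟩
  exact hC _ hm _ hm' (fun h => hne (wcol_inj k n c c' hv hv' h))
    ⟨_, lme_of k n hk hn c y h1, lme_of k n hk hn c' y h2⟩
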